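/- arXiv:0903.5056 — 2 statements merged into one kernel-verified Lean document; each statement's English description precedes it below -/
import Mathlib

section
/- The function w(t) = J₂(t)/J₃(t) is well defined on (0, 1/64) (since J₃(t) > 0 there), is differentiable, and satisfies the Riccati equation (64t² − t)·w′(t) = (−3/2 + 24t)·w(t)² + (4 − 32t)·w(t) − 5/2 for all t ∈ (0, 1/64). -/
open MeasureTheory Set Filter

/-- The region bounded by the real oval of `{x^2 y (1-x-y) = t}` in the first quadrant. -/
def Δset (t : ℝ) : Set (ℝ × ℝ) :=
  {z : ℝ × ℝ | 0 < z.1 ∧ 0 < z.2 ∧ t ≤ z.1 ^ 2 * z.2 * (1 - z.1 - z.2)}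

/-- The Abelian integral `I_{i,j}(t) = ∬_{Δ(t)} x^i y^j dx dy` (integer powers). -/
noncomputable def Iab (i j : ℤ) (t : ℝ) : ℝ :=
  ∫ z in Δset t, z.1 ^ i * z.2 ^ j

noncomputable def J1 (t : ℝ) : ℝ := Iab 0 0 t
noncomputable def J2 (t : ℝ) : ℝ := Iab 2 0 t
noncomputable def J3 (t : ℝ) : ℝ := Iab 3 0 t

/-- The discriminant factor `D = √(b² - a² sin² θ)` with `a² = 1/4 - s`, `b² = 1/4 + s`. -/
noncomputable def ovalRoot (s θ : ℝ) : ℝ :=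
  √(1 / 4 + s - (1 / 4 - s) * Real.sin θ ^ 2)

lemma ovalRoot_arg_ge {s : ℝ} (hs : 0 < s) (θ : ℝ) :
    s ≤ 1 / 4 + s - (1 / 4 - s) * Real.sin θ ^ 2 := by
  nlinarith [Real.sin_sq_le_one θ, sq_nonneg (Real.sin θ)]

lemma ovalRoot_pos {s : ℝ} (hs : 0 < s) (θ : ℝ) : 0 < ovalRoot s θ :=
  Real.sqrt_pos.2 (hs.trans_le (ovalRoot_arg_ge hs θ))

lemma ovalRoot_sq {s : ℝ} (hs : 0 < s) (θ : ℝ) :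
    ovalRoot s θ ^ 2 = 1 / 4 + s - (1 / 4 - s) * Real.sin θ ^ 2 :=
  Real.sq_sqrt (hs.le.trans (ovalRoot_arg_ge hs θ))

@[fun_prop]
lemma continuous_ovalRoot (s : ℝ) : Continuous (ovalRoot s) := by
  unfold ovalRoot
  fun_prop

lemma hasDerivAt_ovalRoot_param {s : ℝ} (hs : 0 < s) (θ : ℝ) :
    HasDerivAt (fun r => ovalRoot r θ) ((1 + Real.sin θ ^ 2) / (2 * ovalRoot s θ)) s := by
  have h : HasDerivAt (fun r : ℝ => 1 / 4 + r - (1 / 4 - r) * Real.sin θ ^ 2)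
      (1 + Real.sin θ ^ 2) s := by
    have := ((hasDerivAt_id s).const_add (1 / 4)).sub
      (((hasDerivAt_id s).const_sub (1 / 4)).mul_const (Real.sin θ ^ 2))
    exact this.congr_deriv (by ring)
  exact h.sqrt (hs.trans_le (ovalRoot_arg_ge hs θ)).ne'

lemma hasDerivAt_ovalRoot {s : ℝ} (hs : 0 < s) (θ : ℝ) :
    HasDerivAt (ovalRoot s)
      (-((1 / 4 - s) * (Real.sin θ * Real.cos θ)) / ovalRoot s θ) θ := by
  have h : HasDerivAt (fun r : ℝ => 1 / 4 + s - (1 / 4 - s) * Real.sin r ^ 2)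
      (-((1 / 4 - s) * (2 * Real.sin θ * Real.cos θ))) θ := by
    have := (((Real.hasDerivAt_sin θ).pow 2).const_mul (1 / 4 - s)).const_sub (1 / 4 + s)
    simpa using this
  refine (h.sqrt (hs.trans_le (ovalRoot_arg_ge hs θ)).ne').congr_deriv ?_
  have := (ovalRoot_pos hs θ).ne'
  change _ / (2 * ovalRoot s θ) = _
  field_simp

lemma hasDerivAt_integral_mul_ovalRoot {s : ℝ} (hs : 0 < s) {g : ℝ → ℝ} (hg : Continuous g)
    (α β : ℝ) :
    HasDerivAt (fun r => ∫ θ in α..β, g θ * ovalRoot r θ)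
      (∫ θ in α..β, g θ * ((1 + Real.sin θ ^ 2) / (2 * ovalRoot s θ))) s := by
  have hD : ∀ r, 0 < r → Continuous fun θ => g θ * ((1 + Real.sin θ ^ 2) / (2 * ovalRoot r θ)) :=
    fun r hr => hg.mul (Continuous.div (by fun_prop) (by fun_prop)
      fun θ => (mul_pos two_pos (ovalRoot_pos hr θ)).ne')
  refine (intervalIntegral.hasDerivAt_integral_of_dominated_loc_of_deriv_le
    (F := fun r θ => g θ * ovalRoot r θ)
    (F' := fun r θ => g θ * ((1 + Real.sin θ ^ 2) / (2 * ovalRoot r θ)))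
    (s := Ioi (s / 2)) (bound := fun θ => |g θ| * (1 / √(s / 2)))
    (Ioi_mem_nhds (by linarith)) (.of_forall fun r => ?_) ?_ ?_ ?_ ?_ ?_).2
  · exact (hg.mul (continuous_ovalRoot r)).aestronglyMeasurable
  · exact (hg.mul (continuous_ovalRoot s)).intervalIntegrable _ _
  · exact (hD s hs).aestronglyMeasurable
  · refine .of_forall fun θ _ r hr => ?_
    have hr' : s / 2 < r := hr
    have hr0 : 0 < r := by linarith
    rw [Real.norm_eq_abs, abs_mul]
    gcongr
    have hroot : √(s / 2) ≤ ovalRoot r θ :=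
      Real.sqrt_le_sqrt (hr'.le.trans (ovalRoot_arg_ge hr0 θ))
    have hpos : 0 < √(s / 2) := Real.sqrt_pos.2 (by linarith)
    rw [abs_of_nonneg (div_nonneg (by positivity) (by linarith)),
      div_le_div_iff₀ (by linarith) hpos]
    nlinarith [Real.sin_sq_le_one θ, sq_nonneg (Real.sin θ)]
  · exact (hg.abs.mul continuous_const).intervalIntegrable _ _
  · refine .of_forall fun θ _ r hr => ?_
    have hr0 : 0 < r := by have : s / 2 < r := hr; linarith
    exact (hasDerivAt_ovalRoot_param hr0 θ).const_mul (g θ)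

/-- The elliptic moment `∫ sin^n θ / D dθ` over `[-π/2, π/2]`. -/
noncomputable def ovalMoment (n : ℕ) (s : ℝ) : ℝ :=
  ∫ θ in (-(Real.pi / 2))..(Real.pi / 2), Real.sin θ ^ n / ovalRoot s θ

lemma continuous_ovalMoment_integrand (n : ℕ) {s : ℝ} (hs : 0 < s) :
    Continuous fun θ => Real.sin θ ^ n / ovalRoot s θ :=
  Continuous.div (by fun_prop) (by fun_prop) fun θ => (ovalRoot_pos hs θ).ne'

lemma integral_eq_ovalMoment {s : ℝ} (hs : 0 < s) {f : ℝ → ℝ} (c₀ c₂ c₄ c₆ : ℝ)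
    (hf : ∀ θ, f θ = (c₀ + c₂ * Real.sin θ ^ 2 + c₄ * Real.sin θ ^ 4 + c₆ * Real.sin θ ^ 6)
      / ovalRoot s θ) :
    ∫ θ in (-(Real.pi / 2))..(Real.pi / 2), f θ =
      c₀ * ovalMoment 0 s + c₂ * ovalMoment 2 s + c₄ * ovalMoment 4 s + c₆ * ovalMoment 6 s := by
  have hi : ∀ (n : ℕ) (c : ℝ), IntervalIntegrable
      (fun θ => c * (Real.sin θ ^ n / ovalRoot s θ)) volume (-(Real.pi / 2)) (Real.pi / 2) :=
    fun n c => ((continuous_ovalMoment_integrand n hs).const_mul c).intervalIntegrable _ _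
  unfold ovalMoment
  simp only [← intervalIntegral.integral_const_mul]
  rw [← intervalIntegral.integral_add (hi _ _) (hi _ _),
    ← intervalIntegral.integral_add ((hi _ _).add (hi _ _)) (hi _ _),
    ← intervalIntegral.integral_add (((hi _ _).add (hi _ _)).add (hi _ _)) (hi _ _)]
  refine intervalIntegral.integral_congr fun θ _ => ?_
  simp only [hf]
  ring

lemma ovalMoment_relation_four {s : ℝ} (hs : 0 < s) :
    (1 / 4 + s) * ovalMoment 0 s - ovalMoment 2 s + 3 * (1 / 4 - s) * ovalMoment 4 s = 0 := by
  have hd : ∀ θ, HasDerivAt (fun θ => Real.sin θ * Real.cos θ * ovalRoot s θ)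
      (((1 / 4 + s) + (-1) * Real.sin θ ^ 2 + (3 * (1 / 4 - s)) * Real.sin θ ^ 4
        + 0 * Real.sin θ ^ 6) / ovalRoot s θ) θ := by
    intro θ
    refine (((Real.hasDerivAt_sin θ).mul (Real.hasDerivAt_cos θ)).mul
      (hasDerivAt_ovalRoot hs θ)).congr_deriv ?_
    have h0 := (ovalRoot_pos hs θ).ne'
    have h1 := ovalRoot_sq hs θ
    have h2 := Real.cos_sq' θ
    simp only [Pi.mul_apply]
    field_simp
    rw [h1, h2]
    ring
  have h := intervalIntegral.integral_eq_sub_of_hasDerivAt (a := -(Real.pi / 2))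
    (b := Real.pi / 2) (fun θ _ => hd θ)
    ((Continuous.div (by fun_prop) (by fun_prop)
      fun θ => (ovalRoot_pos hs θ).ne').intervalIntegrable _ _)
  rw [integral_eq_ovalMoment hs _ _ _ _ fun θ => rfl] at h
  simp only [Real.cos_neg, Real.cos_pi_div_two] at h
  linarith

lemma ovalMoment_relation_six {s : ℝ} (hs : 0 < s) :
    3 * (1 / 4 + s) * ovalMoment 2 s - 2 * ovalMoment 4 s
      + 5 * (1 / 4 - s) * ovalMoment 6 s = 0 := by
  have hd : ∀ θ, HasDerivAt (fun θ => Real.sin θ ^ 3 * Real.cos θ * ovalRoot s θ)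
      ((0 + (3 * (1 / 4 + s)) * Real.sin θ ^ 2 + (-2) * Real.sin θ ^ 4
        + (5 * (1 / 4 - s)) * Real.sin θ ^ 6) / ovalRoot s θ) θ := by
    intro θ
    refine ((((Real.hasDerivAt_sin θ).pow 3).mul (Real.hasDerivAt_cos θ)).mul
      (hasDerivAt_ovalRoot hs θ)).congr_deriv ?_
    have h0 := (ovalRoot_pos hs θ).ne'
    have h1 := ovalRoot_sq hs θ
    have h2 := Real.cos_sq' θ
    simp only [Pi.mul_apply, Pi.pow_apply]
    field_simp
    rw [h1, h2]
    push_cast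
    ring
  have h := intervalIntegral.integral_eq_sub_of_hasDerivAt (a := -(Real.pi / 2))
    (b := Real.pi / 2) (fun θ _ => hd θ)
    ((Continuous.div (by fun_prop) (by fun_prop)
      fun θ => (ovalRoot_pos hs θ).ne').intervalIntegrable _ _)
  rw [integral_eq_ovalMoment hs _ _ _ _ fun θ => rfl] at h
  simp only [Real.cos_neg, Real.cos_pi_div_two] at h
  linarith

lemma oval_fiber {s : ℝ} (hs : 0 < s) {x : ℝ} (hx : s ≤ x * (1 - x)) (hx0 : 0 < x) :
    {y | (x, y) ∈ Δset (s ^ 2 / 4)} =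
      Icc ((1 - x) / 2 - √((x * (1 - x)) ^ 2 - s ^ 2) / (2 * x))
        ((1 - x) / 2 + √((x * (1 - x)) ^ 2 - s ^ 2) / (2 * x)) := by
  have hx1 : 0 < 1 - x := pos_of_mul_pos_right (hs.trans_le hx) hx0.le
  have hd : 0 ≤ (x * (1 - x)) ^ 2 - s ^ 2 := by nlinarith
  ext y
  have hiff : s ^ 2 / 4 ≤ x ^ 2 * y * (1 - x - y) ↔
      (2 * x * (y - (1 - x) / 2)) ^ 2 ≤ (x * (1 - x)) ^ 2 - s ^ 2 := by
    constructor <;> intro h <;> nlinarith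
  have hmain : s ^ 2 / 4 ≤ x ^ 2 * y * (1 - x - y) ↔
      |y - (1 - x) / 2| ≤ √((x * (1 - x)) ^ 2 - s ^ 2) / (2 * x) := by
    rw [hiff, ← sq_abs (2 * x * _), ← Real.le_sqrt (abs_nonneg _) hd, abs_mul, abs_of_pos (by linarith : 0 < 2 * x),
      le_div_iff₀ (by linarith), mul_comm]
  simp only [Δset, mem_ofPred_eq, mem_Icc, hmain]
  rw [abs_le]
  constructor
  · rintro ⟨-, -, h1, h2⟩
    constructor <;> linarith
  · rintro ⟨h1, h2⟩
    have h3 : |y - (1 - x) / 2| ≤ √((x * (1 - x)) ^ 2 - s ^ 2) / (2 * x) :=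
      abs_le.2 ⟨by linarith, by linarith⟩
    refine ⟨hx0, ?_, by linarith, by linarith⟩
    have h4 : 0 < x ^ 2 * y * (1 - x - y) := lt_of_lt_of_le (by positivity) (hmain.2 h3)
    by_contra! hy
    have h5 : 0 < 1 - x - y := by linarith
    have h6 : x ^ 2 * y * (1 - x - y) ≤ 0 :=
      mul_nonpos_of_nonpos_of_nonneg (mul_nonpos_of_nonneg_of_nonpos (by positivity) hy) h5.le
    linarith

lemma le_mul_one_sub_of_mem_oval {s : ℝ} (hs : 0 < s) {x y : ℝ}
    (h : (x, y) ∈ Δset (s ^ 2 / 4)) : 0 < x ∧ 0 < y ∧ x + y < 1 ∧ s ≤ x * (1 - x) := by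
  obtain ⟨hx, hy, h⟩ := h
  simp only at hx hy h
  have hxy : 0 < 1 - x - y :=
    pos_of_mul_pos_right ((by positivity : 0 < s ^ 2 / 4).trans_le h) (by positivity)
  refine ⟨hx, hy, by linarith, ?_⟩
  refine le_of_sq_le_sq ?_ (by nlinarith)
  nlinarith [sq_nonneg (x * (2 * y - (1 - x)))]

lemma mem_Icc_iff_le_mul_one_sub {s : ℝ} (hs' : s < 1 / 4) (x : ℝ) :
    x ∈ Icc (1 / 2 - √(1 / 4 - s)) (1 / 2 + √(1 / 4 - s)) ↔ s ≤ x * (1 - x) := by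
  have h : |x - 1 / 2| ≤ √(1 / 4 - s) ↔ s ≤ x * (1 - x) := by
    rw [Real.le_sqrt (abs_nonneg _) (by linarith), sq_abs]
    constructor <;> intro h <;> nlinarith
  rw [← h, abs_le, mem_Icc]
  constructor <;> rintro ⟨h1, h2⟩ <;> constructor <;> linarith

lemma measurableSet_oval (t : ℝ) : MeasurableSet (Δset t) := by
  have h1 : MeasurableSet {z : ℝ × ℝ | 0 < z.1} := measurableSet_lt (by fun_prop) (by fun_prop)
  have h2 : MeasurableSet {z : ℝ × ℝ | 0 < z.2} := measurableSet_lt (by fun_prop) (by fun_prop)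
  have h3 : MeasurableSet {z : ℝ × ℝ | t ≤ z.1 ^ 2 * z.2 * (1 - z.1 - z.2)} :=
    measurableSet_le (by fun_prop) (by fun_prop)
  exact h1.inter (h2.inter h3)

lemma Iab_succ_zero_eq_integral {s : ℝ} (hs : 0 < s) (hs' : s < 1 / 4) (m : ℕ) :
    Iab (m + 1 : ℕ) 0 (s ^ 2 / 4) =
      ∫ x in (1 / 2 - √(1 / 4 - s))..(1 / 2 + √(1 / 4 - s)),
        x ^ m * √((x * (1 - x)) ^ 2 - s ^ 2) := by
  have hsub : Δset (s ^ 2 / 4) ⊆ Icc (0 : ℝ) 1 ×ˢ Icc (0 : ℝ) 1 := by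
    rintro ⟨x, y⟩ h
    obtain ⟨h1, h2, h3, -⟩ := le_mul_one_sub_of_mem_oval hs h
    exact ⟨⟨h1.le, by simp only; linarith⟩, ⟨h2.le, by simp only; linarith⟩⟩
  have hint : Integrable ((Δset (s ^ 2 / 4)).indicator fun z : ℝ × ℝ => z.1 ^ (m + 1)) := by
    rw [integrable_indicator_iff (measurableSet_oval _)]
    refine IntegrableOn.mono_set ?_ hsub
    exact (by fun_prop : Continuous fun z : ℝ × ℝ => z.1 ^ (m + 1)).continuousOn.integrableOn_compact
      (isCompact_Icc.prod isCompact_Icc)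
  have hle : 1 / 2 - √(1 / 4 - s) ≤ 1 / 2 + √(1 / 4 - s) := by
    linarith [Real.sqrt_nonneg (1 / 4 - s)]
  simp only [Iab, zpow_natCast, zpow_zero, mul_one]
  rw [intervalIntegral.integral_of_le hle, ← integral_Icc_eq_integral_Ioc,
    ← integral_indicator (measurableSet_oval _), ← integral_indicator measurableSet_Icc]
  rw [Measure.volume_eq_prod] at hint ⊢
  rw [integral_prod _ hint]
  congr 1
  ext x
  have hind : (fun y => (Δset (s ^ 2 / 4)).indicator (fun z : ℝ × ℝ => z.1 ^ (m + 1)) (x, y)) =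
      {y | (x, y) ∈ Δset (s ^ 2 / 4)}.indicator fun _ => x ^ (m + 1) := rfl
  rw [hind]
  by_cases hx : s ≤ x * (1 - x)
  · have hx0 : 0 < x := by nlinarith [sq_nonneg x]
    rw [indicator_of_mem ((mem_Icc_iff_le_mul_one_sub hs' x).2 hx), oval_fiber hs hx hx0,
      integral_indicator measurableSet_Icc, setIntegral_const, smul_eq_mul,
      Real.volume_real_Icc_of_le (by
        have : 0 ≤ √((x * (1 - x)) ^ 2 - s ^ 2) / (2 * x) := by positivity
        linarith)]
    field_simp
    ring
  · rw [indicator_of_notMem (fun h => hx ((mem_Icc_iff_le_mul_one_sub hs' x).1 h))]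
    have : {y | (x, y) ∈ Δset (s ^ 2 / 4)} = ∅ :=
      eq_empty_of_forall_notMem fun y hy => hx (le_mul_one_sub_of_mem_oval hs hy).2.2.2
    simp [this]

lemma Iab_succ_zero_eq_trig {s : ℝ} (hs : 0 < s) (hs' : s < 1 / 4) (m : ℕ) :
    Iab (m + 1 : ℕ) 0 (s ^ 2 / 4) =
      ∫ θ in (-(Real.pi / 2))..(Real.pi / 2), (1 / 2 + √(1 / 4 - s) * Real.sin θ) ^ m *
        ((1 / 4 - s) * Real.cos θ ^ 2) * ovalRoot s θ := by
  set a := √(1 / 4 - s)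
  have ha2 : a ^ 2 = 1 / 4 - s := Real.sq_sqrt (by linarith)
  have ha0 : 0 ≤ a := Real.sqrt_nonneg _
  have hcv := intervalIntegral.integral_comp_mul_deriv (a := -(Real.pi / 2)) (b := Real.pi / 2)
    (f := fun θ => 1 / 2 + a * Real.sin θ) (f' := fun θ => a * Real.cos θ)
    (g := fun x => x ^ m * √((x * (1 - x)) ^ 2 - s ^ 2))
    (fun θ _ => ((Real.hasDerivAt_sin θ).const_mul a).const_add _) (by fun_prop) (by fun_prop)
  simp only [Real.sin_neg, Real.sin_pi_div_two, mul_neg, mul_one, ← sub_eq_add_neg] at hcv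
  rw [Iab_succ_zero_eq_integral hs hs', ← hcv]
  refine intervalIntegral.integral_congr fun θ hθ => ?_
  rw [uIcc_of_le (by linarith [Real.pi_pos])] at hθ
  have hcos : 0 ≤ Real.cos θ := Real.cos_nonneg_of_mem_Icc hθ
  have hroot : √(((1 / 2 + a * Real.sin θ) * (1 - (1 / 2 + a * Real.sin θ))) ^ 2 - s ^ 2) =
      a * Real.cos θ * ovalRoot s θ := by
    have harg : ((1 / 2 + a * Real.sin θ) * (1 - (1 / 2 + a * Real.sin θ))) ^ 2 - s ^ 2 =
        (a * Real.cos θ * ovalRoot s θ) ^ 2 := by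
      rw [mul_pow (a * _), mul_pow a, ovalRoot_sq hs, Real.cos_sq', ← sub_eq_zero]
      ring_nf
      rw [show a ^ 4 = (a ^ 2) ^ 2 by ring, ha2]
      ring
    rw [harg, Real.sqrt_sq (mul_nonneg (mul_nonneg ha0 hcos) (ovalRoot_pos hs θ).le)]
  simp only [Function.comp_apply, hroot]
  rw [← ha2]
  ring

/-- The weighted integral `∫ sin^n θ cos² θ D dθ` over `[-π/2, π/2]`. -/
noncomputable def ovalWeight (n : ℕ) (s : ℝ) : ℝ :=
  ∫ θ in (-(Real.pi / 2))..(Real.pi / 2), Real.sin θ ^ n * Real.cos θ ^ 2 * ovalRoot s θ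

lemma ovalWeight_one (s : ℝ) : ovalWeight 1 s = 0 := by
  have h := intervalIntegral.integral_comp_neg (a := -(Real.pi / 2)) (b := Real.pi / 2)
    (fun θ => Real.sin θ ^ 1 * Real.cos θ ^ 2 * ovalRoot s θ)
  simp only [neg_neg, ovalRoot, Real.sin_neg, Real.cos_neg, pow_one, even_two, Even.neg_pow,
    neg_mul, intervalIntegral.integral_neg] at h
  simp only [ovalWeight, ovalRoot, pow_one]
  linarith

lemma J2_eq {s : ℝ} (hs : 0 < s) (hs' : s < 1 / 4) :
    J2 (s ^ 2 / 4) = (1 / 4 - s) / 2 * ovalWeight 0 s := by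
  have hi : ∀ (n : ℕ) (c : ℝ), IntervalIntegrable
      (fun θ => c * (Real.sin θ ^ n * Real.cos θ ^ 2 * ovalRoot s θ)) volume
      (-(Real.pi / 2)) (Real.pi / 2) :=
    fun n c => (by fun_prop : Continuous _).intervalIntegrable _ _
  have h1 : (1 / 4 - s) * √(1 / 4 - s) * ovalWeight 1 s = 0 := by rw [ovalWeight_one, mul_zero]
  have h := Iab_succ_zero_eq_trig hs hs' 1
  refine h.trans ?_
  rw [← add_zero (_ * _), ← h1]
  unfold ovalWeight
  simp only [← intervalIntegral.integral_const_mul]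
  rw [← intervalIntegral.integral_add (hi _ _) (hi _ _)]
  refine intervalIntegral.integral_congr fun θ _ => ?_
  ring

lemma J3_eq {s : ℝ} (hs : 0 < s) (hs' : s < 1 / 4) :
    J3 (s ^ 2 / 4) = (1 / 4 - s) / 4 * ovalWeight 0 s + (1 / 4 - s) ^ 2 * ovalWeight 2 s := by
  have hi : ∀ (n : ℕ) (c : ℝ), IntervalIntegrable
      (fun θ => c * (Real.sin θ ^ n * Real.cos θ ^ 2 * ovalRoot s θ)) volume
      (-(Real.pi / 2)) (Real.pi / 2) :=
    fun n c => (by fun_prop : Continuous _).intervalIntegrable _ _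
  have h1 : (1 / 4 - s) * √(1 / 4 - s) * ovalWeight 1 s = 0 := by rw [ovalWeight_one, mul_zero]
  have h := Iab_succ_zero_eq_trig hs hs' 2
  refine h.trans ?_
  rw [← add_zero (_ + _), ← h1]
  unfold ovalWeight
  simp only [← intervalIntegral.integral_const_mul]
  rw [← intervalIntegral.integral_add (hi _ _) (hi _ _),
    ← intervalIntegral.integral_add ((hi _ _).add (hi _ _)) (hi _ _)]
  refine intervalIntegral.integral_congr fun θ _ => ?_
  have ha2 : √(1 / 4 - s) ^ 2 = 1 / 4 - s := Real.sq_sqrt (by linarith)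
  linear_combination (1 / 4 - s) * Real.sin θ ^ 2 * Real.cos θ ^ 2 * ovalRoot s θ * ha2

lemma hasDerivAt_ovalWeight (n : ℕ) {s : ℝ} (hs : 0 < s) :
    HasDerivAt (ovalWeight n) (∫ θ in (-(Real.pi / 2))..(Real.pi / 2),
      Real.sin θ ^ n * Real.cos θ ^ 2 * ((1 + Real.sin θ ^ 2) / (2 * ovalRoot s θ))) s :=
  hasDerivAt_integral_mul_ovalRoot hs (by fun_prop) _ _

lemma ovalWeight_zero_eq {s : ℝ} (hs : 0 < s) :
    ovalWeight 0 s = (1 / 4 + s) * ovalMoment 0 s - 1 / 2 * ovalMoment 2 s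
      + (1 / 4 - s) * ovalMoment 4 s := by
  have h := integral_eq_ovalMoment hs
    (f := fun θ => Real.sin θ ^ 0 * Real.cos θ ^ 2 * ovalRoot s θ)
    (1 / 4 + s) (-(1 / 2)) (1 / 4 - s) 0 fun θ => by
      rw [eq_div_iff (ovalRoot_pos hs θ).ne', mul_assoc, ← sq, ovalRoot_sq hs, Real.cos_sq']
      ring
  exact h.trans (by ring)

lemma ovalWeight_two_eq {s : ℝ} (hs : 0 < s) :
    ovalWeight 2 s = (1 / 4 + s) * ovalMoment 2 s - 1 / 2 * ovalMoment 4 s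
      + (1 / 4 - s) * ovalMoment 6 s := by
  have h := integral_eq_ovalMoment hs
    (f := fun θ => Real.sin θ ^ 2 * Real.cos θ ^ 2 * ovalRoot s θ)
    0 (1 / 4 + s) (-(1 / 2)) (1 / 4 - s) fun θ => by
      rw [eq_div_iff (ovalRoot_pos hs θ).ne', mul_assoc, ← sq, ovalRoot_sq hs, Real.cos_sq']
      ring
  exact h.trans (by ring)

lemma hasDerivAt_ovalWeight_zero {s : ℝ} (hs : 0 < s) :
    HasDerivAt (ovalWeight 0) ((ovalMoment 0 s - ovalMoment 4 s) / 2) s := by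
  refine (hasDerivAt_ovalWeight 0 hs).congr_deriv ?_
  rw [integral_eq_ovalMoment hs (1 / 2) 0 (-(1 / 2)) 0 fun θ => ?_]
  · ring
  · have := (ovalRoot_pos hs θ).ne'
    rw [Real.cos_sq']
    field_simp
    ring

lemma hasDerivAt_ovalWeight_two {s : ℝ} (hs : 0 < s) :
    HasDerivAt (ovalWeight 2) ((ovalMoment 2 s - ovalMoment 6 s) / 2) s := by
  refine (hasDerivAt_ovalWeight 2 hs).congr_deriv ?_
  rw [integral_eq_ovalMoment hs 0 (1 / 2) 0 (-(1 / 2)) fun θ => ?_]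
  · ring
  · have := (ovalRoot_pos hs θ).ne'
    rw [Real.cos_sq']
    field_simp
    ring

lemma ovalWeight_pos {s : ℝ} (hs : 0 < s) : 0 < ovalWeight 0 s := by
  refine intervalIntegral.intervalIntegral_pos_of_pos_on
    ((by fun_prop : Continuous _).intervalIntegrable _ _) (fun θ hθ => ?_)
    (by linarith [Real.pi_pos])
  have := Real.cos_pos_of_mem_Ioo hθ
  have := ovalRoot_pos hs θ
  positivity

lemma ovalWeight_two_nonneg (s : ℝ) : 0 ≤ ovalWeight 2 s := by
  refine intervalIntegral.integral_nonneg (by linarith [Real.pi_pos]) fun θ _ => ?_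
  have : 0 ≤ ovalRoot s θ := Real.sqrt_nonneg _
  positivity

lemma two_mul_sqrt_mem_Ioo {t : ℝ} (ht : t ∈ Ioo (0 : ℝ) (1 / 64)) :
    2 * √t ∈ Ioo (0 : ℝ) (1 / 4) := by
  have h1 : 0 < √t := Real.sqrt_pos.2 ht.1
  have h2 : √t < 1 / 8 := (Real.sqrt_lt' (by norm_num)).2 (by linarith [ht.2])
  exact ⟨by linarith, by linarith⟩

lemma two_mul_sqrt_sq_div_four {t : ℝ} (ht : 0 < t) : (2 * √t) ^ 2 / 4 = t := by
  rw [mul_pow, Real.sq_sqrt ht.le]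
  ring

lemma hasDerivAt_two_mul_sqrt {t : ℝ} (ht : 0 < t) :
    HasDerivAt (fun r => 2 * √r) (2 / (2 * √t)) t :=
  ((Real.hasDerivAt_sqrt ht.ne').const_mul 2).congr_deriv (by ring)

lemma hasDerivAt_J2 {t : ℝ} (ht : t ∈ Ioo (0 : ℝ) (1 / 64)) :
    HasDerivAt J2 (-ovalMoment 0 (2 * √t)) t := by
  obtain ⟨hs, hs'⟩ := two_mul_sqrt_mem_Ioo ht
  have hev : J2 =ᶠ[nhds t]
      (fun s => (1 / 4 - s) / 2 * ovalWeight 0 s) ∘ fun r => 2 * √r := by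
    filter_upwards [Ioo_mem_nhds ht.1 ht.2] with r hr
    have := two_mul_sqrt_mem_Ioo hr
    rw [Function.comp_apply, ← J2_eq this.1 this.2, two_mul_sqrt_sq_div_four hr.1]
  refine HasDerivAt.congr_of_eventuallyEq ?_ hev
  have h := (((hasDerivAt_id (2 * √t)).const_sub (1 / 4)).div_const 2).mul
    (hasDerivAt_ovalWeight_zero hs)
  refine (h.comp t (hasDerivAt_two_mul_sqrt ht.1)).congr_deriv ?_
  simp only [id, ovalWeight_zero_eq hs]
  have h4 := ovalMoment_relation_four hs
  generalize 2 * √t = s at *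
  field_simp
  linear_combination (-4) * h4

lemma hasDerivAt_J3 {t : ℝ} (ht : t ∈ Ioo (0 : ℝ) (1 / 64)) :
    HasDerivAt J3 (-2 * (ovalMoment 0 (2 * √t) / 4
      + (1 / 4 - 2 * √t) * ovalMoment 2 (2 * √t))) t := by
  obtain ⟨hs, hs'⟩ := two_mul_sqrt_mem_Ioo ht
  have hev : J3 =ᶠ[nhds t]
      (fun s => (1 / 4 - s) / 4 * ovalWeight 0 s + (1 / 4 - s) ^ 2 * ovalWeight 2 s) ∘
        fun r => 2 * √r := by
    filter_upwards [Ioo_mem_nhds ht.1 ht.2] with r hr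
    have := two_mul_sqrt_mem_Ioo hr
    rw [Function.comp_apply, ← J3_eq this.1 this.2, two_mul_sqrt_sq_div_four hr.1]
  refine HasDerivAt.congr_of_eventuallyEq ?_ hev
  have hp := (hasDerivAt_id (2 * √t)).const_sub (1 / 4)
  have h := ((hp.div_const 4).mul (hasDerivAt_ovalWeight_zero hs)).add
    ((hp.pow 2).mul (hasDerivAt_ovalWeight_two hs))
  refine (h.comp t (hasDerivAt_two_mul_sqrt ht.1)).congr_deriv ?_
  simp only [id, ovalWeight_zero_eq hs, ovalWeight_two_eq hs, Pi.pow_apply]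
  have h4 := ovalMoment_relation_four hs
  have h6 := ovalMoment_relation_six hs
  generalize 2 * √t = s at *
  field_simp
  push_cast
  linear_combination (-4) * h4 - 16 * (1 / 4 - s) * h6

lemma J3_pos {t : ℝ} (ht : t ∈ Ioo (0 : ℝ) (1 / 64)) : 0 < J3 t := by
  obtain ⟨hs, hs'⟩ := two_mul_sqrt_mem_Ioo ht
  rw [← two_mul_sqrt_sq_div_four ht.1, J3_eq hs hs']
  have h1 := mul_pos (by linarith : 0 < (1 / 4 - 2 * √t) / 4) (ovalWeight_pos hs)
  have h2 := mul_nonneg (sq_nonneg (1 / 4 - 2 * √t)) (ovalWeight_two_nonneg (2 * √t))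
  linarith

lemma J2_eq_ovalMoment {s : ℝ} (hs : 0 < s) (hs' : s < 1 / 4) :
    J2 (s ^ 2 / 4) = (1 / 16 - s ^ 2) / 3 * ovalMoment 0 s
      - (1 / 4 - s) / 12 * ovalMoment 2 s := by
  rw [J2_eq hs hs', ovalWeight_zero_eq hs]
  linear_combination (1 / 4 - s) / 6 * ovalMoment_relation_four hs

lemma J3_eq_ovalMoment {s : ℝ} (hs : 0 < s) (hs' : s < 1 / 4) :
    J3 (s ^ 2 / 4) = (1 / 16 - s ^ 2) / 5 * ovalMoment 0 s
      + (1 / 4 - s) * (2 / 5 * (1 / 16 - s ^ 2) - 3 / 40) * ovalMoment 2 s := by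
  rw [J3_eq hs hs', ovalWeight_zero_eq hs, ovalWeight_two_eq hs]
  linear_combination (1 / 4 - s) / 20 * ovalMoment_relation_four hs
    + (1 / 4 - s) ^ 2 / 5 * ovalMoment_relation_six hs

/-- `w = J₂/J₃` is well defined (`J₃ > 0`), differentiable, and satisfies
the Riccati equation (13) of the paper. -/
theorem riccati_equation (t : ℝ) (ht : t ∈ Set.Ioo (0 : ℝ) (1 / 64)) :
    0 < J3 t ∧
    DifferentiableAt ℝ (fun s : ℝ => J2 s / J3 s) t ∧
    (64 * t ^ 2 - t) * deriv (fun s : ℝ => J2 s / J3 s) t =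
      (-(3 / 2) + 24 * t) * (J2 t / J3 t) ^ 2 + (4 - 32 * t) * (J2 t / J3 t) - 5 / 2 := by
  have hpos := J3_pos ht
  have hd := (hasDerivAt_J2 ht).fun_div (hasDerivAt_J3 ht) hpos.ne'
  refine ⟨hpos, hd.differentiableAt, ?_⟩
  rw [hd.deriv]
  obtain ⟨hs, hs'⟩ := two_mul_sqrt_mem_Ioo ht
  have h2 := J2_eq_ovalMoment hs hs'
  have h3 := J3_eq_ovalMoment hs hs'
  have hst := two_mul_sqrt_sq_div_four ht.1
  rw [hst] at h2 h3
  generalize 2 * √t = s at *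
  have hne := hpos.ne'
  field_simp
  rw [h2, h3, ← hst]
  ring
end

section
/- Let a < b be reals, let S : (a, b) → ℝ be differentiable, let g, A, B, C : (a, b) → ℝ be continuous with g(t) ≠ 0 for all t ∈ (a, b), and suppose g(t)·S′(t) = A(t)·S(t)² + B(t)·S(t) + C(t) for all t ∈ (a, b). If t₁ < t₂ are two points of (a, b) with S(t₁) = S(t₂) = 0, then there exists s ∈ [t₁, t₂] with C(s) = 0. -/
/-- Between two zeros, a differentiable function cannot cross zero strictly upwards at every zero. -/
theorem exists_zero_deriv_nonpos {f : ℝ → ℝ} {u v : ℝ} (huv : u < v)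
    (hf : ∀ t ∈ Set.Icc u v, DifferentiableAt ℝ f t) (hu : f u = 0) (hv : f v = 0) :
    ∃ t ∈ Set.Icc u v, f t = 0 ∧ deriv f t ≤ 0 := by
  by_contra! h
  have nonneg : ∀ t ∈ Set.Icc u v, 0 ≤ f t := fun t ht =>
    image_le_of_deriv_right_lt_deriv_boundary' (f := fun _ => 0) (f' := fun _ => 0)
      (B' := deriv f) continuousOn_const (fun _ _ => hasDerivWithinAt_const ..) hu.ge
      (fun x hx => (hf x hx).continuousAt.continuousWithinAt)
      (fun x hx => (hf x (Set.Ico_subset_Icc_self hx)).hasDerivAt.hasDerivWithinAt)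
      (fun x hx hx0 => h x (Set.Ico_subset_Icc_self hx) hx0.symm) ht
  have hv_mem : v ∈ Set.Icc u v := Set.right_mem_Icc.2 huv.le
  have slope_pos : ∀ᶠ x in nhdsWithin v (Set.Iio v), 0 < slope f v x :=
    ((hf v hv_mem).hasDerivAt.tendsto_slope.mono_left
      (nhdsWithin_mono v fun x (hx : x < v) => hx.ne)).eventually_const_lt (h v hv_mem hv)
  obtain ⟨x, hx, hxu⟩ := (slope_pos.and (Ioo_mem_nhdsLT huv)).exists
  rw [slope_def_field, hv, sub_zero] at hx
  exact hx.not_ge (div_nonpos_of_nonneg_of_nonpos (nonneg x ⟨hxu.1.le, hxu.2.le⟩)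
    (sub_nonpos.2 hxu.2.le))

/-- Between two zeros of a differentiable function, its derivative is nonpositive at some zero and
nonnegative at some zero, so a continuous function that agrees with it at the zeros vanishes. -/
theorem exists_eq_zero_of_deriv_eq_on_zeros {f D : ℝ → ℝ} {u v : ℝ} (huv : u < v)
    (hf : ∀ t ∈ Set.Icc u v, DifferentiableAt ℝ f t) (hD : ContinuousOn D (Set.Icc u v))
    (hfD : ∀ t ∈ Set.Icc u v, f t = 0 → deriv f t = D t) (hu : f u = 0) (hv : f v = 0) :
    ∃ s ∈ Set.Icc u v, D s = 0 := by
  obtain ⟨x, hx, hx0, hx'⟩ := exists_zero_deriv_nonpos huv hf hu hv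
  obtain ⟨y, hy, hy0, hy'⟩ := exists_zero_deriv_nonpos (f := -f) huv
    (fun t ht => (hf t ht).neg) (by simp [hu]) (by simp [hv])
  rw [Pi.neg_apply, neg_eq_zero] at hy0
  rw [deriv.neg, neg_nonpos, hfD y hy hy0] at hy'
  rw [hfD x hx hx0] at hx'
  exact isPreconnected_Icc.intermediate_value hx hy hD ⟨hx', hy'⟩

/-- zero-separation principle for Riccati-type equations: between two
zeros of a solution `S` of `g S' = A S² + B S + C` (with `g ≠ 0`) lies a zero of `C`. -/
theorem riccati_zero_separation (a b : ℝ) (hab : a < b)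
    (S g A B C : ℝ → ℝ)
    (hS : ∀ t ∈ Set.Ioo a b, DifferentiableAt ℝ S t)
    (hg : ContinuousOn g (Set.Ioo a b)) (hA : ContinuousOn A (Set.Ioo a b))
    (hB : ContinuousOn B (Set.Ioo a b)) (hC : ContinuousOn C (Set.Ioo a b))
    (hgne : ∀ t ∈ Set.Ioo a b, g t ≠ 0)
    (heq : ∀ t ∈ Set.Ioo a b,
      g t * deriv S t = A t * S t ^ 2 + B t * S t + C t)
    (t₁ t₂ : ℝ) (ht₁ : t₁ ∈ Set.Ioo a b) (ht₂ : t₂ ∈ Set.Ioo a b) (hlt : t₁ < t₂)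
    (hS₁ : S t₁ = 0) (hS₂ : S t₂ = 0) :
    ∃ s ∈ Set.Icc t₁ t₂, C s = 0 := by
  have hsub : Set.Icc t₁ t₂ ⊆ Set.Ioo a b := Set.Icc_subset_Ioo ht₁.1 ht₂.2
  obtain ⟨s, hs, hs0⟩ := exists_eq_zero_of_deriv_eq_on_zeros (D := fun t => C t / g t) hlt
    (fun t ht => hS t (hsub ht)) ((hC.div hg hgne).mono hsub)
    (fun t ht h0 => by
      rw [eq_div_iff (hgne t (hsub ht)), mul_comm, heq t (hsub ht), h0]
      ring) hS₁ hS₂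
  exact ⟨s, hs, (div_eq_zero_iff.1 hs0).resolve_right (hgne s (hsub hs))⟩
end
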